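/- In the slack-allocation game with the linear clearing rule, for any coalition K, if every player outside K defects (C j > L j for all j not in K), then the coalition's aggregate payoff never exceeds its aggregate entitlement: ∑_{i ∈ K} π i ≤ ∑_{i ∈ K} L i. Consequently the dominant-strategy (all-defect) profile, at which each coalition receives exactly ∑_{i ∈ K} L i, admits no coalition deviation that strictly increases the coalition's total payoff (Strong Nash under transferable utility). -/

import Mathlib

/-- Overage of player `j`: `v j = max (C j - L j) 0`. -/
noncomputable def overage {n : ℕ} (L C : Fin n → ℝ) (j : Fin n) : ℝ :=
  max (C j - L j) 0

/-- Slack of player `j`: `s j = max (L j - C j) 0`. -/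
noncomputable def slack {n : ℕ} (L C : Fin n → ℝ) (j : Fin n) : ℝ :=
  max (L j - C j) 0

/-- Aggregate overage `X = ∑ j, v j`. -/
noncomputable def totOverage {n : ℕ} (L C : Fin n → ℝ) : ℝ :=
  ∑ j, overage L C j

/-- Aggregate slack `I = ∑ j, s j`. -/
noncomputable def totSlack {n : ℕ} (L C : Fin n → ℝ) : ℝ :=
  ∑ j, slack L C j

/-- Covered overage under the linear clearing rule:
`v̂ j = v j` if `X ≤ I`, and `v̂ j = (I / X) * v j` if `X > I`. -/
noncomputable def covered {n : ℕ} (L C : Fin n → ℝ) (j : Fin n) : ℝ :=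
  if totOverage L C ≤ totSlack L C then overage L C j
  else (totSlack L C / totOverage L C) * overage L C j

/-- Payoff: `π j = C j` if `C j ≤ L j`, and `π j = L j + v̂ j` if `C j > L j`. -/
noncomputable def payoff {n : ℕ} (L C : Fin n → ℝ) (j : Fin n) : ℝ :=
  if C j ≤ L j then C j else L j + covered L C j

lemma overage_nonneg {n : ℕ} (L C : Fin n → ℝ) (j : Fin n) : 0 ≤ overage L C j :=
  le_max_right _ _

lemma totOverage_nonneg {n : ℕ} (L C : Fin n → ℝ) : 0 ≤ totOverage L C :=
  Finset.sum_nonneg fun j _ => overage_nonneg L C j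

lemma slack_nonneg {n : ℕ} (L C : Fin n → ℝ) (j : Fin n) : 0 ≤ slack L C j :=
  le_max_right _ _

lemma totSlack_nonneg {n : ℕ} (L C : Fin n → ℝ) : 0 ≤ totSlack L C :=
  Finset.sum_nonneg fun j _ => slack_nonneg L C j

lemma slack_eq_zero_of_lt {n : ℕ} {L C : Fin n → ℝ} {j : Fin n} (h : L j < C j) :
    slack L C j = 0 :=
  max_eq_right (by linarith)

lemma covered_nonneg {n : ℕ} (L C : Fin n → ℝ) (j : Fin n) : 0 ≤ covered L C j := by
  unfold covered
  split_ifs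
  · exact overage_nonneg L C j
  · exact mul_nonneg (div_nonneg (totSlack_nonneg L C) (totOverage_nonneg L C))
      (overage_nonneg L C j)

lemma sum_covered_le_totSlack {n : ℕ} (L C : Fin n → ℝ) :
    ∑ j, covered L C j ≤ totSlack L C := by
  unfold covered
  split_ifs with h
  · exact h
  · have hX : totOverage L C ≠ 0 := by
      have := totSlack_nonneg L C
      linarith
    rw [← Finset.mul_sum, ← totOverage, div_mul_cancel₀ _ hX]

lemma payoff_eq {n : ℕ} (L C : Fin n → ℝ) (j : Fin n) :
    payoff L C j = L j + covered L C j - slack L C j := by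
  unfold payoff
  split_ifs with h
  · have hv : overage L C j = 0 := max_eq_right (by linarith)
    have hs : slack L C j = L j - C j := max_eq_left (by linarith)
    simp [covered, hv, hs]
  · rw [slack_eq_zero_of_lt (not_le.mp h), sub_zero]

/-- If everyone outside `K` defects, then `K` owns all the slack, so its aggregate payoff is at
most its aggregate entitlement. -/
lemma sum_payoff_le {n : ℕ} (L C : Fin n → ℝ) (K : Finset (Fin n))
    (h : ∀ j, j ∉ K → L j < C j) : ∑ i ∈ K, payoff L C i ≤ ∑ i ∈ K, L i := by
  have hs : ∑ i ∈ K, slack L C i = totSlack L C :=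
    Finset.sum_subset K.subset_univ fun j _ hj => slack_eq_zero_of_lt (h j hj)
  have hc : ∑ i ∈ K, covered L C i ≤ ∑ i, covered L C i :=
    Finset.sum_le_univ_sum_of_nonneg (covered_nonneg L C)
  have := sum_covered_le_totSlack L C
  simp only [payoff_eq, Finset.sum_sub_distrib, Finset.sum_add_distrib]
  linarith

lemma sum_payoff_eq_of_forall_lt {n : ℕ} (L C : Fin n → ℝ) (K : Finset (Fin n))
    (h : ∀ j, L j < C j) : ∑ i ∈ K, payoff L C i = ∑ i ∈ K, L i := by
  refine le_antisymm (sum_payoff_le L C K fun j _ => h j) (Finset.sum_le_sum fun i _ => ?_)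
  rw [payoff_eq, slack_eq_zero_of_lt (h i)]
  linarith [covered_nonneg L C i]

/-- Strong Nash under transferable utility at the dominant-strategy (all-defect)
profile: (a) whenever everyone outside a coalition `K` defects, the coalition's
aggregate payoff never exceeds its aggregate entitlement; (b) at any all-defect
profile each coalition receives exactly its aggregate entitlement; hence (c) no
coalition deviation from the all-defect profile strictly increases the
coalition's total payoff. -/
theorem strong_nash_TU {n : ℕ} (L : Fin n → ℝ) (hL : ∀ j, 0 < L j)
    (K : Finset (Fin n)) :
    (∀ C : Fin n → ℝ, (∀ j, 0 ≤ C j) → (∀ j, j ∉ K → L j < C j) →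
        (∑ i ∈ K, payoff L C i) ≤ ∑ i ∈ K, L i) ∧
    (∀ CDS : Fin n → ℝ, (∀ j, L j < CDS j) →
        (∑ i ∈ K, payoff L CDS i) = ∑ i ∈ K, L i) ∧
    (∀ CDS C' : Fin n → ℝ, (∀ j, L j < CDS j) → (∀ j, 0 ≤ C' j) →
        (∀ j, j ∉ K → C' j = CDS j) →
        ¬ (∑ i ∈ K, payoff L CDS i) < ∑ i ∈ K, payoff L C' i) := by
  refine ⟨fun C _ h => sum_payoff_le L C K h,
    fun CDS h => sum_payoff_eq_of_forall_lt L CDS K h, fun CDS C' h _ hK => ?_⟩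
  rw [not_lt, sum_payoff_eq_of_forall_lt L CDS K h]
  exact sum_payoff_le L C' K fun j hj => hK j hj ▸ h j
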